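/- arXiv:1808.04185 — 3 statements merged into one kernel-verified Lean document; each statement's English description precedes it below -/
import Mathlib

section
/- For c = 1.645, the function φ_c is monotonically nondecreasing on the interval (0, 1/2]; that is, for all α, β with 0 < α ≤ β ≤ 1/2, one has φ_c(α) ≤ φ_c(β). -/
open Real

/-- `φ_c(α) = c^(2-α) / (α^α · (c-α)^(2-2α))` for `α ≠ 0`, and `φ_c(0) = 1`. -/
noncomputable def phi (c α : ℝ) : ℝ :=
  if α = 0 then 1 else c ^ (2 - α) / (α ^ α * (c - α) ^ (2 - 2 * α))

/-- The logarithm of `φ_c` on `(0, c)`. -/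
noncomputable def logPhi (c α : ℝ) : ℝ :=
  (2 - α) * log c - (α * log α + (2 - 2 * α) * log (c - α))

lemma phi_eq_exp_logPhi {c α : ℝ} (hα : 0 < α) (hc : α < c) :
    phi c α = exp (logPhi c α) := by
  have hc0 : 0 < c := hα.trans hc
  have hcα : 0 < c - α := sub_pos.2 hc
  rw [phi, if_neg hα.ne', logPhi, exp_sub, exp_add, rpow_def_of_pos hc0, rpow_def_of_pos hα,
    rpow_def_of_pos hcα, mul_comm (log c), mul_comm (log α), mul_comm (log (c - α))]

lemma hasDerivAt_logPhi {c α : ℝ} (hα : 0 < α) (hc : α < c) :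
    HasDerivAt (logPhi c)
      (-log c - log α - 1 + 2 * log (c - α) + (2 - 2 * α) / (c - α)) α := by
  have hcα : c - α ≠ 0 := (sub_pos.2 hc).ne'
  have h1 : HasDerivAt (fun x : ℝ => (2 - x) * log c) (-1 * log c) α :=
    ((hasDerivAt_id α).const_sub 2).mul_const _
  have h2 : HasDerivAt (fun x : ℝ => x * log x) (log α + 1) α := hasDerivAt_mul_log hα.ne'
  have h3 : HasDerivAt (fun x : ℝ => 2 - 2 * x) (-(2 * 1)) α :=
    ((hasDerivAt_id α).const_mul 2).const_sub 2
  have h4 : HasDerivAt (fun x : ℝ => log (c - x)) (-1 / (c - α)) α :=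
    ((hasDerivAt_id α).const_sub c).log hcα
  refine (h1.sub (h2.add (h3.mul h4))).congr_deriv ?_
  ring

/-- Nonnegativity of the derivative of `logPhi c`, by `log y ≥ 1 - y⁻¹` at
`y = (c - α) ^ 2 / (c * α)`. -/
lemma deriv_logPhi_nonneg {c α : ℝ} (hα : 0 < α) (hc : α < c)
    (h : c * α ≤ (2 - 2 * α) * (c - α)) :
    0 ≤ -log c - log α - 1 + 2 * log (c - α) + (2 - 2 * α) / (c - α) := by
  have hc0 : 0 < c := hα.trans hc
  have hcα : 0 < c - α := sub_pos.2 hc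
  have hlog : log (c * α / (c - α) ^ 2) = log c + log α - 2 * log (c - α) := by
    rw [log_div (by positivity) (by positivity), log_mul hc0.ne' hα.ne', log_pow]
    norm_num
  have hle := log_le_sub_one_of_pos (show 0 < c * α / (c - α) ^ 2 by positivity)
  have hfrac : c * α / (c - α) ^ 2 ≤ (2 - 2 * α) / (c - α) := by
    rw [div_le_div_iff₀ (by positivity) hcα]
    nlinarith [mul_le_mul_of_nonneg_right h hcα.le]
  linarith

lemma monotoneOn_logPhi : MonotoneOn (logPhi 1.645) (Set.Ioc 0 (1 / 2)) := by
  have hd : ∀ x ∈ Set.Ioc (0 : ℝ) (1 / 2), HasDerivAt (logPhi 1.645)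
      (-log 1.645 - log x - 1 + 2 * log (1.645 - x) + (2 - 2 * x) / (1.645 - x)) x :=
    fun x hx => hasDerivAt_logPhi hx.1 (by linarith [hx.2])
  refine monotoneOn_of_deriv_nonneg (convex_Ioc 0 (1 / 2))
    (fun x hx => (hd x hx).continuousAt.continuousWithinAt)
    (fun x hx => (hd x (interior_subset hx)).differentiableAt.differentiableWithinAt)
    fun x hx => ?_
  obtain ⟨h0, h1⟩ := interior_subset hx
  rw [(hd x ⟨h0, h1⟩).deriv]
  exact deriv_logPhi_nonneg h0 (by linarith) (by nlinarith)

/-- For `c = 1.645`, the function `φ_c` is monotonically nondecreasing on `(0, 1/2]`. -/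
theorem stmt_8 (α β : ℝ) (hα : 0 < α) (hαβ : α ≤ β) (hβ : β ≤ 1 / 2) :
    phi 1.645 α ≤ phi 1.645 β := by
  rw [phi_eq_exp_logPhi hα (by linarith), phi_eq_exp_logPhi (hα.trans_le hαβ) (by linarith)]
  exact exp_le_exp.2
    (monotoneOn_logPhi ⟨hα, hαβ.trans hβ⟩ ⟨hα.trans_le hαβ, hβ⟩ hαβ)
end

section
/- Let δ = 0.49533 and ζ = 0.712, and set L = (1-ζ)·δ, R = 1-δ+ζ·δ, and Y3 = (ζ^ζ·(1-ζ)^(1-ζ))^δ / (L^L · R^R). Then (3/2 + √5/2)^R · Y3 < 2.5537. -/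
open Real

/-- `δ = 0.49533`. -/
noncomputable def del : ℝ := 0.49533
/-- `ζ = 0.712`. -/
noncomputable def zet : ℝ := 0.712
/-- `L = (1-ζ)·δ`. -/
noncomputable def Lv : ℝ := (1 - zet) * del
/-- `R = 1 - δ + ζ·δ`. -/
noncomputable def Rv : ℝ := 1 - del + zet * del
/-- `Y3 = (ζ^ζ·(1-ζ)^(1-ζ))^δ / (L^L · R^R)`. -/
noncomputable def Y3 : ℝ := (zet ^ zet * (1 - zet) ^ (1 - zet)) ^ del / (Lv ^ Lv * Rv ^ Rv)

/-- Explicit error bound for the expansion of `log v` in odd powers of `(v - 1) / (v + 1)`. -/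
lemma abs_log_sub_sum_range_le {v : ℝ} (hv : 0 < v) (n : ℕ) :
    |log v - 2 * ∑ i ∈ Finset.range n, ((v - 1) / (v + 1)) ^ (2 * i + 1) / (2 * i + 1)| ≤
      2 * (|(v - 1) / (v + 1)| ^ (2 * n + 1) / (1 - ((v - 1) / (v + 1)) ^ 2)) := by
  have hx : |(v - 1) / (v + 1)| < 1 := by
    rw [abs_lt, lt_div_iff₀ (by linarith), div_lt_one (by linarith)]
    constructor <;> linarith
  have hv' : (1 + (v - 1) / (v + 1)) / (1 - (v - 1) / (v + 1)) = v := by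
    have h1 : v + 1 ≠ 0 := by positivity
    have h2 : 1 - (v - 1) / (v + 1) = 2 / (v + 1) := by field_simp; ring
    rw [h2]
    field_simp
    ring
  have h := sum_range_sub_log_div_le hx n
  rw [hv', abs_le] at h
  rw [abs_le]
  constructor <;> linarith [h.1, h.2]

lemma log_lt_of_golden_sq_approx : log 2.6180341 < 0.9624238 := by
  have h := abs_log_sub_sum_range_le (v := 2.6180341) (by norm_num) 12
  norm_num [Finset.sum_range_succ, abs_le] at h ⊢
  linarith [h.2]

lemma log_zet_lt : log zet < -0.339677 := by
  have h := abs_log_sub_sum_range_le (v := 0.712) (by norm_num) 5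
  norm_num [zet, Finset.sum_range_succ, abs_le] at h ⊢
  linarith [h.2]

lemma lt_log_del : -0.702532 < log del := by
  have h := abs_log_sub_sum_range_le (v := 0.49533) (by norm_num) 8
  norm_num [del, Finset.sum_range_succ, abs_le] at h ⊢
  linarith [h.1]

lemma lt_log_Rv : -0.153915 < log Rv := by
  have h := abs_log_sub_sum_range_le (v := 0.85734496) (by norm_num) 4
  norm_num [Rv, zet, del, Finset.sum_range_succ, abs_le] at h ⊢
  linarith [h.1]

lemma lt_log_bound : 0.937543 < log 2.5537 := by
  have h := abs_log_sub_sum_range_le (v := 2.5537) (by norm_num) 10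
  norm_num [Finset.sum_range_succ, abs_le] at h ⊢
  linarith [h.1]

/-- The terms in `log (1 - zet)` cancel. -/
lemma log_Y3 : log Y3 = del * zet * log zet - Lv * log del - Rv * log Rv := by
  have hz : 0 < zet := by norm_num [zet]
  have hz' : 0 < 1 - zet := by norm_num [zet]
  have hd : 0 < del := by norm_num [del]
  have hL : 0 < Lv := mul_pos hz' hd
  have hR : 0 < Rv := by norm_num [Rv, zet, del]
  have hlogL : log Lv = log (1 - zet) + log del := log_mul hz'.ne' hd.ne'
  rw [Y3, log_div (by positivity) (by positivity), log_rpow (by positivity),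
    log_mul (by positivity) (by positivity), log_mul (by positivity) (by positivity),
    log_rpow hz, log_rpow hz', log_rpow hL, log_rpow hR, hlogL, Lv]
  ring

/-- With `δ = 0.49533` and `ζ = 0.712`, one has `(3/2 + √5/2)^R · Y3 < 2.5537`. -/
theorem stmt_11 : (3 / 2 + Real.sqrt 5 / 2) ^ Rv * Y3 < 2.5537 := by
  have hz : 0 < zet := by norm_num [zet]
  have hz' : 0 < 1 - zet := by norm_num [zet]
  have hd : 0 < del := by norm_num [del]
  have hL : 0 < Lv := mul_pos hz' hd
  have hR : 0 < Rv := by norm_num [Rv, zet, del]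
  have hY3 : 0 < Y3 := by unfold Y3; positivity
  have hsqrt : √5 < 2.2360682 := by
    rw [sqrt_lt' (by norm_num)]
    norm_num
  have hlog : log (3 / 2 + √5 / 2) < 0.9624238 :=
    (log_lt_log (by positivity) (by linarith)).trans log_lt_of_golden_sq_approx
  rw [← log_lt_log_iff (by positivity) (by norm_num), log_mul (by positivity) hY3.ne',
    log_rpow (by positivity), log_Y3]
  have h1 := mul_lt_mul_of_pos_left hlog hR
  have h2 := mul_lt_mul_of_pos_left log_zet_lt (mul_pos hd hz)
  have h3 := mul_lt_mul_of_pos_left lt_log_del hL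
  have h4 := mul_lt_mul_of_pos_left lt_log_Rv hR
  have hnum : Rv * 0.9624238 + del * zet * -0.339677 - Lv * -0.702532 - Rv * -0.153915 <
      0.937543 := by
    norm_num [Rv, Lv, zet, del]
  linarith [lt_log_bound]
end

section
/- Let c = 1 + 1/√5 and let b be a real number with 0 ≤ b ≤ 1 - 1/√5. Then the supremum of φ_c(α) over α ∈ [b,1] with α > 0 equals 3/2 + √5/2, and it is attained at α = 1 - 1/√5. -/
open Real

theorem log_phi {c α : ℝ} (hc : 0 < c) (hα : 0 < α) (hαc : α < c) :
    Real.log (phi c α) =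
      (2 - α) * Real.log c - α * Real.log α - (2 - 2 * α) * Real.log (c - α) := by
  have hca : 0 < c - α := sub_pos.2 hαc
  rw [phi, if_neg hα.ne', Real.log_div (Real.rpow_pos_of_pos hc _).ne' (by positivity),
    Real.log_mul (Real.rpow_pos_of_pos hα _).ne' (Real.rpow_pos_of_pos hca _).ne',
    Real.log_rpow hc, Real.log_rpow hα, Real.log_rpow hca]
  ring

theorem phi_pos {c α : ℝ} (hc : 0 < c) (hα : 0 < α) (hαc : α < c) : 0 < phi c α := by
  have hca : 0 < c - α := sub_pos.2 hαc
  rw [phi, if_neg hα.ne']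
  positivity

theorem two_mul_log_two_mul {s : ℝ} (hs0 : 0 < s) (hs1 : s < 1) (hs : s ^ 2 = 1 / 5) :
    2 * Real.log (2 * s) = Real.log (1 + s) + Real.log (1 - s) := by
  rw [← Real.log_mul (by linarith) (by linarith),
    show (1 + s) * (1 - s) = (2 * s) ^ 2 by linear_combination -5 * hs, Real.log_pow]
  norm_num

theorem phi_one_add_one_sub {s : ℝ} (hs0 : 0 < s) (hs1 : s < 1) (hs : s ^ 2 = 1 / 5) :
    phi (1 + s) (1 - s) = (1 + s) / (1 - s) := by
  have hc : 0 < 1 + s := by linarith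
  have ha : 0 < 1 - s := by linarith
  refine Real.log_injOn_pos (phi_pos hc ha (by linarith)) (div_pos hc ha) ?_
  rw [log_phi hc ha (by linarith), Real.log_div hc.ne' ha.ne',
    show 1 + s - (1 - s) = 2 * s by ring]
  linear_combination -s * two_mul_log_two_mul hs0 hs1 hs

/-- Tangent-line bound for the logarithm, scaled to the point `y`. -/
theorem log_sub_log_le {x y : ℝ} (hx : 0 < x) (hy : 0 < y) :
    Real.log y - Real.log x ≤ y / x - 1 := by
  rw [← Real.log_div hy.ne' hx.ne']
  exact Real.log_le_sub_one_of_pos (div_pos hy hx)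

theorem phi_one_add_le {s α : ℝ} (hs0 : 0 < s) (hs1 : s < 1) (hs : s ^ 2 = 1 / 5)
    (hα0 : 0 < α) (hα1 : α ≤ 1) : phi (1 + s) α ≤ (1 + s) / (1 - s) := by
  have hc : 0 < 1 + s := by linarith
  have ha : 0 < 1 - s := by linarith
  have hαc : α < 1 + s := by linarith
  have hca : 0 < 1 + s - α := sub_pos.2 hαc
  rw [← Real.log_le_log_iff (phi_pos hc hα0 hαc) (div_pos hc ha), log_phi hc hα0 hαc,
    Real.log_div hc.ne' ha.ne']
  have h₁ := mul_le_mul_of_nonneg_left (log_sub_log_le hα0 ha) hα0.le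
  have h₂ := mul_le_mul_of_nonneg_left (log_sub_log_le hca (by linarith : 0 < 2 * s))
    (by linarith : 0 ≤ 2 - 2 * α)
  have h₃ : α * ((1 - s) / α - 1) + (2 - 2 * α) * (2 * s / (1 + s - α) - 1) =
      -((α - (1 - s)) ^ 2 / (1 + s - α)) := by
    field_simp
    ring
  have h₄ : 0 ≤ (α - (1 - s)) ^ 2 / (1 + s - α) := by positivity
  have h₅ := congrArg (fun t => (1 - α) * t) (two_mul_log_two_mul hs0 hs1 hs)
  linarith

/-- For `c = 1 + 1/√5` and `0 ≤ b ≤ 1 - 1/√5`, the value `3/2 + √5/2` is the greatest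
value of `φ_c(α)` over `α ∈ [b,1]` with `α > 0` (so the supremum of `φ_c` there equals
`3/2 + √5/2`), and it is attained at `α = 1 - 1/√5`. -/
theorem stmt_13 (b : ℝ) (hb0 : 0 ≤ b) (hb : b ≤ 1 - 1 / Real.sqrt 5) :
    IsGreatest ((fun α => phi (1 + 1 / Real.sqrt 5) α) ''
        {α : ℝ | b ≤ α ∧ α ≤ 1 ∧ 0 < α}) (3 / 2 + Real.sqrt 5 / 2) ∧
      phi (1 + 1 / Real.sqrt 5) (1 - 1 / Real.sqrt 5) = 3 / 2 + Real.sqrt 5 / 2 := by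
  have h5 : Real.sqrt 5 ^ 2 = 5 := Real.sq_sqrt (by norm_num)
  have h1 : 1 < Real.sqrt 5 := Real.lt_sqrt_of_sq_lt (by norm_num)
  have hs0 : 0 < 1 / Real.sqrt 5 := by positivity
  have hs1 : 1 / Real.sqrt 5 < 1 := (div_lt_one (by linarith)).2 h1
  have hs : (1 / Real.sqrt 5) ^ 2 = 1 / 5 := by rw [div_pow, h5, one_pow]
  have hval : (1 + 1 / Real.sqrt 5) / (1 - 1 / Real.sqrt 5) = 3 / 2 + Real.sqrt 5 / 2 := by
    rw [div_eq_iff (by linarith)]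
    field_simp
    linear_combination -h5
  have hmax := (phi_one_add_one_sub hs0 hs1 hs).trans hval
  refine ⟨⟨⟨_, ⟨hb, by linarith, by linarith⟩, hmax⟩, ?_⟩, hmax⟩
  rintro _ ⟨α, ⟨-, hα1, hα0⟩, rfl⟩
  exact (phi_one_add_le hs0 hs1 hs hα0 hα1).trans_eq hval
end
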